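/- arXiv:1809.07809 — 10 statements merged into one kernel-verified Lean document; each statement's English description precedes it below -/
import Mathlib

section
/- For every integer n ≥ 0, the Tribonacci-Lucas matrix sequence satisfies 𝒦_n = [[K_{n+1}, K_n + K_{n-1}, K_n], [K_n, K_{n-1} + K_{n-2}, K_{n-1}], [K_{n-1}, K_{n-2} + K_{n-3}, K_{n-2}]], where the entries are Tribonacci-Lucas numbers (with indices extended to negative integers). -/
theorem tribonacci_lucas_matrix_entries
    (K : ℤ → ℤ)
    (hK : ∀ n : ℤ, K n = K (n - 1) + K (n - 2) + K (n - 3))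
    (hK0 : K 0 = 3) (hK1 : K 1 = 1) (hK2 : K 2 = 3)
    (𝒦 : ℤ → Matrix (Fin 3) (Fin 3) ℤ)
    (h𝒦 : ∀ n : ℤ, 𝒦 n = 𝒦 (n - 1) + 𝒦 (n - 2) + 𝒦 (n - 3))
    (h𝒦0 : 𝒦 0 = !![1, 2, 3; 3, -2, -1; -1, 4, -1])
    (h𝒦1 : 𝒦 1 = !![3, 4, 1; 1, 2, 3; 3, -2, -1])
    (h𝒦2 : 𝒦 2 = !![7, 4, 3; 3, 4, 1; 1, 2, 3]) :
    ∀ n : ℤ, 0 ≤ n →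
      𝒦 n = !![K (n + 1), K n + K (n - 1), K n;
               K n, K (n - 1) + K (n - 2), K (n - 1);
               K (n - 1), K (n - 2) + K (n - 3), K (n - 2)] := by
  have a3 : K 3 = 7 := by have := hK 3; norm_num at this; omega
  have b1 : K (-1) = -1 := by have := hK 2; norm_num at this; omega
  have b2 : K (-2) = -1 := by have := hK 1; norm_num at this; omega
  have b3 : K (-3) = 5 := by have := hK 0; norm_num at this; omega
  set M : ℤ → Matrix (Fin 3) (Fin 3) ℤ := fun n =>
    !![K (n + 1), K n + K (n - 1), K n;
       K n, K (n - 1) + K (n - 2), K (n - 1);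
       K (n - 1), K (n - 2) + K (n - 3), K (n - 2)] with hM
  have hMr : ∀ n : ℤ, M n = M (n - 1) + M (n - 2) + M (n - 3) := by
    intro n
    have e0 := hK (n + 1)
    have e1 := hK n
    have e2 := hK (n - 1)
    have e3 := hK (n - 2)
    have e4 := hK (n - 3)
    ring_nf at e0 e1 e2 e3 e4
    ext i j
    fin_cases i <;> fin_cases j <;> simp [hM] <;> ring_nf <;> linarith
  have key : ∀ m : ℕ, 𝒦 m = M m ∧ 𝒦 (m + 1) = M (m + 1) ∧ 𝒦 (m + 2) = M (m + 2) := by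
    intro m
    induction m with
    | zero =>
      refine ⟨?_, ?_, ?_⟩
      · simp [hM, h𝒦0, hK0, hK1, b1, b2, b3]
      · simp [hM, h𝒦1, hK0, hK1, hK2, b1, b2]
      · simp [hM, h𝒦2, hK0, hK1, hK2, a3, b1]
    | succ m ih =>
      obtain ⟨h0, h1, h2⟩ := ih
      have r1 : ((m + 1 : ℕ) : ℤ) = m + 1 := by push_cast; ring
      have r2 : (m : ℤ) + 1 + 1 = m + 2 := by ring
      have r3 : (m : ℤ) + 1 + 2 = m + 3 := by ring
      rw [r1, r2, r3]
      refine ⟨h1, h2, ?_⟩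
      rw [h𝒦, hMr]
      have s1 : (m : ℤ) + 3 - 1 = m + 2 := by ring
      have s2 : (m : ℤ) + 3 - 2 = m + 1 := by ring
      have s3 : (m : ℤ) + 3 - 3 = m := by ring
      rw [s1, s2, s3, h0, h1, h2]
  intro n hn
  obtain ⟨m, rfl⟩ := Int.eq_ofNat_of_zero_le hn
  exact (key m).1
end

section
/- Let α, β, γ be the three distinct complex roots of x³ − x² − x − 1 = 0. For every integer n ≥ 0, viewing the matrices with entries in ℂ, the Tribonacci matrix sequence satisfies the Binet formula 𝒯_n = A₁·αⁿ + B₁·βⁿ + C₁·γⁿ, where A₁ = (α𝒯₂ + α(α−1)𝒯₁ + 𝒯₀)/(α(α−γ)(α−β)), B₁ = (β𝒯₂ + β(β−1)𝒯₁ + 𝒯₀)/(β(β−γ)(β−α)), and C₁ = (γ𝒯₂ + γ(γ−1)𝒯₁ + 𝒯₀)/(γ(γ−β)(γ−α)). -/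
lemma tri_coef (α β γ a b c : ℂ) (h0 : α ≠ 0) (e1 : α + β + γ = 1) (e3 : α * β * γ = 1) :
    (α * (α - γ) * (α - β))⁻¹ * (α * c + α * (α - 1) * b + a)
      = (c - (β + γ) * b + β * γ * a) / ((α - γ) * (α - β)) := by
  have : α * c + α * (α - 1) * b + a = α * (c - (β + γ) * b + β * γ * a) := by
    linear_combination (α * b) * e1 - a * e3
  rw [this, mul_assoc α, mul_inv, div_eq_mul_inv]
  field_simp

lemma tri_scalar (t : ℕ → ℂ) (ht : ∀ n, t (n + 3) = t (n + 2) + t (n + 1) + t n)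
    (α β γ : ℂ)
    (hα : α ^ 3 - α ^ 2 - α - 1 = 0)
    (hβ : β ^ 3 - β ^ 2 - β - 1 = 0)
    (hγ : γ ^ 3 - γ ^ 2 - γ - 1 = 0)
    (hαβ : α ≠ β) (hαγ : α ≠ γ) (hβγ : β ≠ γ) (n : ℕ) :
    t n = α ^ n * ((α * (α - γ) * (α - β))⁻¹ * (α * t 2 + α * (α - 1) * t 1 + t 0))
      + β ^ n * ((β * (β - γ) * (β - α))⁻¹ * (β * t 2 + β * (β - 1) * t 1 + t 0))
      + γ ^ n * ((γ * (γ - β) * (γ - α))⁻¹ * (γ * t 2 + γ * (γ - 1) * t 1 + t 0)) := by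
  have d1 := sub_ne_zero.2 hαβ
  have d2 := sub_ne_zero.2 hαγ
  have d3 := sub_ne_zero.2 hβγ
  have d1' := sub_ne_zero.2 hαβ.symm
  have d2' := sub_ne_zero.2 hαγ.symm
  have d3' := sub_ne_zero.2 hβγ.symm
  have f1 : α ^ 2 + α * β + β ^ 2 - α - β - 1 = 0 := by
    apply mul_left_cancel₀ d1; linear_combination hα - hβ
  have f2 : α ^ 2 + α * γ + γ ^ 2 - α - γ - 1 = 0 := by
    apply mul_left_cancel₀ d2; linear_combination hα - hγ
  have e1 : α + β + γ = 1 := by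
    apply mul_left_cancel₀ d3; linear_combination f1 - f2
  have e3 : α * β * γ = 1 := by
    have : γ = 1 - α - β := by linear_combination e1
    subst this
    linear_combination hα - α * f1
  have n1 : α ≠ 0 := by rintro rfl; simp at e3
  have n2 : β ≠ 0 := by rintro rfl; simp at e3
  have n3 : γ ≠ 0 := by rintro rfl; simp at e3
  rw [tri_coef α β γ _ _ _ n1 e1 e3,
    tri_coef β α γ _ _ _ n2 (by linear_combination e1) (by linear_combination e3),
    tri_coef γ α β _ _ _ n3 (by linear_combination e1) (by linear_combination e3)]
  induction n using Nat.strong_induction_on with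
  | _ n ih =>
    match n, ih with
    | 0, _ =>
      rw [← neg_sub α β, ← neg_sub β γ, ← neg_sub α γ]
      field_simp
      ring
    | 1, _ =>
      rw [← neg_sub α β, ← neg_sub β γ, ← neg_sub α γ]
      field_simp
      ring
    | 2, _ =>
      rw [← neg_sub α β, ← neg_sub β γ, ← neg_sub α γ]
      field_simp
      ring
    | k + 3, ih =>
      rw [ht, ih k (by omega), ih (k+1) (by omega), ih (k+2) (by omega)]
      generalize (t 2 - (β + γ) * t 1 + β * γ * t 0) / ((α - γ) * (α - β)) = A
      generalize (t 2 - (α + γ) * t 1 + α * γ * t 0) / ((β - γ) * (β - α)) = B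
      generalize (t 2 - (α + β) * t 1 + α * β * t 0) / ((γ - β) * (γ - α)) = C
      linear_combination (-α ^ k * A) * hα - (β ^ k * B) * hβ - (γ ^ k * C) * hγ

theorem tribonacci_matrix_binet
    (𝒯 : ℤ → Matrix (Fin 3) (Fin 3) ℤ)
    (h𝒯 : ∀ n : ℤ, 𝒯 n = 𝒯 (n - 1) + 𝒯 (n - 2) + 𝒯 (n - 3))
    (h𝒯0 : 𝒯 0 = 1)
    (h𝒯1 : 𝒯 1 = !![1, 1, 1; 1, 0, 0; 0, 1, 0])
    (h𝒯2 : 𝒯 2 = !![2, 2, 1; 1, 1, 1; 1, 0, 0])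
    (α β γ : ℂ)
    (hα : α ^ 3 - α ^ 2 - α - 1 = 0)
    (hβ : β ^ 3 - β ^ 2 - β - 1 = 0)
    (hγ : γ ^ 3 - γ ^ 2 - γ - 1 = 0)
    (hαβ : α ≠ β) (hαγ : α ≠ γ) (hβγ : β ≠ γ) :
    ∀ n : ℤ, 0 ≤ n →
      (𝒯 n).map (fun x : ℤ => (x : ℂ)) =
        α ^ n • ((α * (α - γ) * (α - β))⁻¹ •
            (α • (𝒯 2).map (fun x : ℤ => (x : ℂ)) +
              (α * (α - 1)) • (𝒯 1).map (fun x : ℤ => (x : ℂ)) +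
              (𝒯 0).map (fun x : ℤ => (x : ℂ)))) +
        β ^ n • ((β * (β - γ) * (β - α))⁻¹ •
            (β • (𝒯 2).map (fun x : ℤ => (x : ℂ)) +
              (β * (β - 1)) • (𝒯 1).map (fun x : ℤ => (x : ℂ)) +
              (𝒯 0).map (fun x : ℤ => (x : ℂ)))) +
        γ ^ n • ((γ * (γ - β) * (γ - α))⁻¹ •
            (γ • (𝒯 2).map (fun x : ℤ => (x : ℂ)) +
              (γ * (γ - 1)) • (𝒯 1).map (fun x : ℤ => (x : ℂ)) +
              (𝒯 0).map (fun x : ℤ => (x : ℂ)))) := by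
  intro n hn
  lift n to ℕ using hn
  ext i j
  have := tri_scalar (fun n : ℕ => ((𝒯 n i j : ℤ) : ℂ)) (fun n => by
    have h := congrFun (congrFun (h𝒯 ((n + 3 : ℕ) : ℤ)) i) j
    have a1 : ((n + 3 : ℕ) : ℤ) - 1 = ((n + 2 : ℕ) : ℤ) := by push_cast; ring
    have a2 : ((n + 3 : ℕ) : ℤ) - 2 = ((n + 1 : ℕ) : ℤ) := by push_cast; ring
    have a3 : ((n + 3 : ℕ) : ℤ) - 3 = (n : ℤ) := by push_cast; ring
    rw [a1, a2, a3] at h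
    simp only [Matrix.add_apply] at h
    exact_mod_cast h) α β γ hα hβ hγ hαβ hαγ hβγ n
  simpa only [Matrix.add_apply, Matrix.smul_apply, Matrix.map_apply, smul_eq_mul, zpow_natCast,
    Nat.cast_ofNat, Nat.cast_one, Nat.cast_zero] using this
end

section
/- Let α, β, γ be the three distinct complex roots of x³ − x² − x − 1 = 0. For every integer n ≥ 0, viewing the matrices with entries in ℂ, the Tribonacci-Lucas matrix sequence satisfies the Binet formula 𝒦_n = A₂·αⁿ + B₂·βⁿ + C₂·γⁿ, where A₂ = (α𝒦₂ + α(α−1)𝒦₁ + 𝒦₀)/(α(α−γ)(α−β)), B₂ = (β𝒦₂ + β(β−1)𝒦₁ + 𝒦₀)/(β(β−γ)(β−α)), and C₂ = (γ𝒦₂ + γ(γ−1)𝒦₁ + 𝒦₀)/(γ(γ−β)(γ−α)). -/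
lemma coef_aux (a b c x y z : ℂ) (h1 : a + b + c = 1) (h3 : a * b * c = 1) :
    (a * (a - c) * (a - b))⁻¹ * (a * z + a * (a - 1) * y + x) =
      (z - (b + c) * y + b * c * x) / ((a - c) * (a - b)) := by
  have ha : a ≠ 0 := by
    rintro rfl
    simp at h3
  have e : a * z + a * (a - 1) * y + x = a * (z - (b + c) * y + b * c * x) := by
    linear_combination a * y * h1 - x * h3
  rw [e, mul_assoc a, mul_inv, div_eq_inv_mul]
  field_simp

lemma scalar_binet (f : ℕ → ℂ) (hf : ∀ n, f (n + 3) = f (n + 2) + f (n + 1) + f n)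
    (a b c : ℂ)
    (ha : a ^ 3 - a ^ 2 - a - 1 = 0)
    (hb : b ^ 3 - b ^ 2 - b - 1 = 0)
    (hc : c ^ 3 - c ^ 2 - c - 1 = 0)
    (hab : a ≠ b) (hac : a ≠ c) (hbc : b ≠ c) (n : ℕ) :
    f n = a ^ n * ((a * (a - c) * (a - b))⁻¹ * (a * f 2 + a * (a - 1) * f 1 + f 0)) +
      b ^ n * ((b * (b - c) * (b - a))⁻¹ * (b * f 2 + b * (b - 1) * f 1 + f 0)) +
      c ^ n * ((c * (c - b) * (c - a))⁻¹ * (c * f 2 + c * (c - 1) * f 1 + f 0)) := by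
  have h₁ : a - b ≠ 0 := sub_ne_zero.mpr hab
  have h₂ : a - c ≠ 0 := sub_ne_zero.mpr hac
  have h₃ : b - c ≠ 0 := sub_ne_zero.mpr hbc
  have h₁' : b - a ≠ 0 := sub_ne_zero.mpr hab.symm
  have h₂' : c - a ≠ 0 := sub_ne_zero.mpr hac.symm
  have h₃' : c - b ≠ 0 := sub_ne_zero.mpr hbc.symm
  have p : a ^ 2 + a * b + b ^ 2 - a - b - 1 = 0 := by
    apply mul_left_cancel₀ h₁
    linear_combination ha - hb
  have q : a ^ 2 + a * c + c ^ 2 - a - c - 1 = 0 := by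
    apply mul_left_cancel₀ h₂
    linear_combination ha - hc
  have s1 : a + b + c = 1 := by
    apply mul_left_cancel₀ h₃
    linear_combination p - q
  have hc' : c = 1 - a - b := by linear_combination s1
  have s3 : a * b * c = 1 := by
    rw [hc']
    linear_combination ha - a * p
  rw [coef_aux a b c _ _ _ s1 s3,
    coef_aux b a c _ _ _ (by linear_combination s1) (by linear_combination s3),
    coef_aux c a b _ _ _ (by linear_combination s1) (by linear_combination s3)]
  generalize hA : (f 2 - (b + c) * f 1 + b * c * f 0) / ((a - c) * (a - b)) = A
  generalize hB : (f 2 - (a + c) * f 1 + a * c * f 0) / ((b - c) * (b - a)) = B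
  generalize hC : (f 2 - (a + b) * f 1 + a * b * f 0) / ((c - b) * (c - a)) = C
  have key : ∀ n, f n = a ^ n * A + b ^ n * B + c ^ n * C ∧
      f (n + 1) = a ^ (n + 1) * A + b ^ (n + 1) * B + c ^ (n + 1) * C ∧
      f (n + 2) = a ^ (n + 2) * A + b ^ (n + 2) * B + c ^ (n + 2) * C := by
    intro n
    induction n with
    | zero =>
      have e1 : b - a = -(a - b) := by ring
      have e2 : c - a = -(a - c) := by ring
      have e3 : c - b = -(b - c) := by ring
      rw [← hA, ← hB, ← hC, e1, e2, e3]
      refine ⟨?_, ?_, ?_⟩ <;> (field_simp; ring)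
    | succ n ih =>
      obtain ⟨i0, i1, i2⟩ := ih
      refine ⟨i1, i2, ?_⟩
      have := hf n
      rw [show n + 1 + 2 = n + 3 by ring, this, i0, i1, i2]
      linear_combination (-(a ^ n * A)) * ha - b ^ n * B * hb - c ^ n * C * hc
  exact (key n).1

theorem tribonacci_lucas_matrix_binet
    (𝒦 : ℤ → Matrix (Fin 3) (Fin 3) ℤ)
    (h𝒦 : ∀ n : ℤ, 𝒦 n = 𝒦 (n - 1) + 𝒦 (n - 2) + 𝒦 (n - 3))
    (h𝒦0 : 𝒦 0 = !![1, 2, 3; 3, -2, -1; -1, 4, -1])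
    (h𝒦1 : 𝒦 1 = !![3, 4, 1; 1, 2, 3; 3, -2, -1])
    (h𝒦2 : 𝒦 2 = !![7, 4, 3; 3, 4, 1; 1, 2, 3])
    (α β γ : ℂ)
    (hα : α ^ 3 - α ^ 2 - α - 1 = 0)
    (hβ : β ^ 3 - β ^ 2 - β - 1 = 0)
    (hγ : γ ^ 3 - γ ^ 2 - γ - 1 = 0)
    (hαβ : α ≠ β) (hαγ : α ≠ γ) (hβγ : β ≠ γ) :
    ∀ n : ℤ, 0 ≤ n →
      (𝒦 n).map (fun x : ℤ => (x : ℂ)) =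
        α ^ n • ((α * (α - γ) * (α - β))⁻¹ •
            (α • (𝒦 2).map (fun x : ℤ => (x : ℂ)) +
              (α * (α - 1)) • (𝒦 1).map (fun x : ℤ => (x : ℂ)) +
              (𝒦 0).map (fun x : ℤ => (x : ℂ)))) +
        β ^ n • ((β * (β - γ) * (β - α))⁻¹ •
            (β • (𝒦 2).map (fun x : ℤ => (x : ℂ)) +
              (β * (β - 1)) • (𝒦 1).map (fun x : ℤ => (x : ℂ)) +
              (𝒦 0).map (fun x : ℤ => (x : ℂ)))) +
        γ ^ n • ((γ * (γ - β) * (γ - α))⁻¹ •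
            (γ • (𝒦 2).map (fun x : ℤ => (x : ℂ)) +
              (γ * (γ - 1)) • (𝒦 1).map (fun x : ℤ => (x : ℂ)) +
              (𝒦 0).map (fun x : ℤ => (x : ℂ)))) := by
  intro n hn
  obtain ⟨m, rfl⟩ := Int.eq_ofNat_of_zero_le hn
  ext i j
  have := scalar_binet (fun k : ℕ => ((𝒦 (k : ℤ) i j : ℤ) : ℂ)) (by
    intro k
    have h := h𝒦 ((k + 3 : ℕ) : ℤ)
    rw [show (((k + 3 : ℕ) : ℤ) - 1) = ((k + 2 : ℕ) : ℤ) by push_cast; ring,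
      show (((k + 3 : ℕ) : ℤ) - 2) = ((k + 1 : ℕ) : ℤ) by push_cast; ring,
      show (((k + 3 : ℕ) : ℤ) - 3) = (k : ℤ) by push_cast; ring] at h
    simp only [h, Matrix.add_apply, Int.cast_add]) α β γ hα hβ hγ hαβ hαγ hβγ m
  simpa only [Matrix.add_apply, Matrix.smul_apply, Matrix.map_apply, smul_eq_mul,
    zpow_natCast, Nat.cast_ofNat, Nat.cast_one, Nat.cast_zero] using this
end

section
/- For all integers m > j ≥ 0 and every n ≥ 0, the Tribonacci matrix sequence satisfies (K_m − K_{−m}) · ∑_{i=0}^{n−1} 𝒯_{mi+j} = 𝒯_{mn+m+j} + 𝒯_{mn−m+j} + (1 − K_m)·𝒯_{mn+j} − (𝒯_{m+j} + 𝒯_{j−m} + (1 − K_m)·𝒯_j), where K denotes the Tribonacci-Lucas numbers. -/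
theorem trib_zero {M : Type*} [AddCommGroup M] (f : ℤ → M)
    (hf : ∀ n : ℤ, f n = f (n - 1) + f (n - 2) + f (n - 3))
    (h0 : f 0 = 0) (h1 : f 1 = 0) (h2 : f 2 = 0) : ∀ n, f n = 0 := by
  have key : ∀ n : ℤ, f n = 0 ∧ f (n + 1) = 0 ∧ f (n + 2) = 0 := by
    intro n
    induction n using Int.induction_on with
    | zero => simpa using ⟨h0, h1, h2⟩
    | succ i ih =>
      obtain ⟨a, b, c⟩ := ih
      refine ⟨b, ?_, ?_⟩
      · rw [← c]; congr 1
      · rw [hf, show (i : ℤ) + 1 + 2 - 1 = i + 2 by ring, show (i : ℤ) + 1 + 2 - 2 = i + 1 by ring,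
          show (i : ℤ) + 1 + 2 - 3 = i by ring, a, b, c]; simp
    | pred i ih =>
      obtain ⟨a, b, c⟩ := ih
      have e := hf (-(i : ℤ) + 2)
      rw [show -(i : ℤ) + 2 - 1 = -i + 1 by ring, show -(i : ℤ) + 2 - 2 = -i by ring,
          show -(i : ℤ) + 2 - 3 = -i - 1 by ring, a, b, c] at e
      refine ⟨by simpa using e.symm, ?_, ?_⟩
      · rw [← a]; congr 1; ring
      · rw [← b]; congr 1; ring
  exact fun n => (key n).1

theorem trib_unique {M : Type*} [AddCommGroup M] (f g : ℤ → M)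
    (hf : ∀ n : ℤ, f n = f (n - 1) + f (n - 2) + f (n - 3))
    (hg : ∀ n : ℤ, g n = g (n - 1) + g (n - 2) + g (n - 3))
    (h0 : f 0 = g 0) (h1 : f 1 = g 1) (h2 : f 2 = g 2) (n : ℤ) : f n = g n := by
  have := trib_zero (fun n => f n - g n)
    (fun n => by rw [hf n, hg n]; abel)
    (by simp [h0]) (by simp [h1]) (by simp [h2]) n
  exact sub_eq_zero.mp this

theorem adj_three (X : Matrix (Fin 3) (Fin 3) ℤ) :
    X * X = X.trace • X - X.adjugate.trace • (1 : Matrix (Fin 3) (Fin 3) ℤ) + X.adjugate := by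
  rw [Matrix.adjugate_fin_three]
  ext i j
  simp only [Matrix.add_apply, Matrix.sub_apply, Matrix.smul_apply, smul_eq_mul]
  fin_cases i <;> fin_cases j <;>
    simp [-zsmul_eq_mul, Matrix.smul_apply, Matrix.one_apply, Matrix.mul_apply, Fin.sum_univ_three,
      Matrix.trace_fin_three] <;> ring

theorem tribonacci_matrix_sum
    (K : ℤ → ℤ)
    (hK : ∀ n : ℤ, K n = K (n - 1) + K (n - 2) + K (n - 3))
    (hK0 : K 0 = 3) (hK1 : K 1 = 1) (hK2 : K 2 = 3)
    (𝒯 : ℤ → Matrix (Fin 3) (Fin 3) ℤ)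
    (h𝒯 : ∀ n : ℤ, 𝒯 n = 𝒯 (n - 1) + 𝒯 (n - 2) + 𝒯 (n - 3))
    (h𝒯0 : 𝒯 0 = 1)
    (h𝒯1 : 𝒯 1 = !![1, 1, 1; 1, 0, 0; 0, 1, 0])
    (h𝒯2 : 𝒯 2 = !![2, 2, 1; 1, 1, 1; 1, 0, 0])
    (m j : ℤ) (hj : 0 ≤ j) (hjm : j < m) :
    ∀ n : ℕ,
      (K m - K (-m)) • (∑ i ∈ Finset.range n, 𝒯 (m * (i : ℤ) + j)) =
        𝒯 (m * (n : ℤ) + m + j) + 𝒯 (m * (n : ℤ) - m + j) +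
          (1 - K m) • 𝒯 (m * (n : ℤ) + j) -
        (𝒯 (m + j) + 𝒯 (j - m) + (1 - K m) • 𝒯 j) := by
  have hT3 : 𝒯 3 = 𝒯 2 + 𝒯 1 + 𝒯 0 := by simpa using h𝒯 3
  have hs : ∀ a b : ℤ, 𝒯 (a + b) = 𝒯 (a + b - 1) + 𝒯 (a + b - 2) + 𝒯 (a + b - 3) :=
    fun a b => h𝒯 _
  have h22 : 𝒯 2 = 𝒯 1 * 𝒯 1 := by rw [h𝒯1, h𝒯2]; decide
  have h1 : ∀ a, 𝒯 (a + 1) = 𝒯 a * 𝒯 1 := by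
    apply trib_unique
    · intro n
      rw [h𝒯 (n + 1)]
      congr 2
      · congr 1; congr 1; ring
      · congr 1; ring
      · ring
    · intro n
      conv_lhs => rw [h𝒯 n]
      simp only [add_mul]
    · simp [h𝒯0]
    · exact h22
    · rw [show (2 : ℤ) + 1 = 3 by norm_num, hT3, h𝒯0, h𝒯1, h𝒯2]; decide
  have hadd : ∀ a b, 𝒯 (a + b) = 𝒯 a * 𝒯 b := by
    intro a
    apply trib_unique
    · intro n
      rw [h𝒯 (a + n)]
      simp only [add_sub_assoc]
    · intro n
      conv_lhs => rw [h𝒯 n]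
      simp only [mul_add]
    · simp [h𝒯0]
    · exact h1 a
    · rw [show a + 2 = a + 1 + 1 by ring, h1, h1, h22, mul_assoc]
  have htr : ∀ n, K n = (𝒯 n).trace := by
    apply trib_unique _ _ hK
    · intro n
      conv_lhs => rw [h𝒯 n]
      simp only [Matrix.trace_add]
    · simp [hK0, h𝒯0]
    · rw [hK1, h𝒯1]; decide
    · rw [hK2, h𝒯2]; decide
  have hd1 : (𝒯 1).det = 1 := by rw [h𝒯1]; simp [Matrix.det_fin_three]
  have hdet : ∀ n : ℤ, (𝒯 n).det = 1 := by
    intro n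
    induction n using Int.induction_on with
    | zero => simp [h𝒯0]
    | succ i ih => rw [h1, Matrix.det_mul, ih, hd1, one_mul]
    | pred i ih =>
      have := h1 (-(i : ℤ) - 1)
      rw [sub_add_cancel] at this
      rw [this, Matrix.det_mul, hd1, mul_one] at ih
      exact ih
  have hinv : 𝒯 (-m) = (𝒯 m).adjugate := by
    have e : 𝒯 (-m) * 𝒯 m = 1 := by rw [← hadd]; simp [h𝒯0]
    have e2 : 𝒯 m * (𝒯 m).adjugate = 1 := by rw [Matrix.mul_adjugate, hdet, one_smul]
    calc 𝒯 (-m) = 𝒯 (-m) * (𝒯 m * (𝒯 m).adjugate) := by rw [e2, mul_one]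
      _ = _ := by rw [← mul_assoc, e, one_mul]
  have hrec : ∀ a, 𝒯 (a + m + m) = K m • 𝒯 (a + m) - K (-m) • 𝒯 a + 𝒯 (a - m) := by
    intro a
    have e := adj_three (𝒯 m)
    rw [← hinv, ← htr, ← htr] at e
    rw [sub_eq_add_neg a m, hadd (a + m), hadd a m, hadd a (-m), mul_assoc, e]
    simp only [mul_add, mul_sub, mul_smul_comm, mul_one]
  intro n
  induction n with
  | zero => simp [show -m + j = j - m by ring]
  | succ n ih =>
    rw [Finset.sum_range_succ, smul_add, ih]
    have e := hrec (m * n + j)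
    rw [show m * (n : ℤ) + m + j = m * n + j + m by ring,
      show m * (n : ℤ) - m + j = m * n + j - m by ring]
    push_cast
    rw [show m * ((n : ℤ) + 1) + m + j = m * n + j + m + m by ring,
      show m * ((n : ℤ) + 1) - m + j = m * n + j by ring,
      show m * ((n : ℤ) + 1) + j = m * n + j + m by ring, e]
    module
end

section
/- For all integers m > j ≥ 0 and every n ≥ 0: (K_m − K_{−m}) · ∑_{i=0}^{n−1} T_{mi+j} = T_{mn+m+j} + T_{mn−m+j} + (1 − K_m)·T_{mn+j} − (T_{m+j} + T_{j−m} + (1 − K_m)·T_j), and (K_m − K_{−m}) · ∑_{i=0}^{n−1} K_{mi+j} = K_{mn+m+j} + K_{mn−m+j} + (1 − K_m)·K_{mn+j} − (K_{m+j} + K_{j−m} + (1 − K_m)·K_j). -/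
/-- A Tribonacci-type sequence over the integers with three zero initial values vanishes. -/
lemma trib_zero_s8 (X : ℤ → ℤ) (h : ∀ n, X n = X (n - 1) + X (n - 2) + X (n - 3))
    (h0 : X 0 = 0) (h1 : X 1 = 0) (h2 : X 2 = 0) (n : ℤ) : X n = 0 := by
  have key : ∀ n : ℤ, X n = 0 ∧ X (n + 1) = 0 ∧ X (n + 2) = 0 := by
    intro n
    induction n using Int.induction_on with
    | zero => simp [h0, h1, h2]
    | succ k ih =>
      obtain ⟨a, b, c⟩ := ih
      have e := h ((k : ℤ) + 3)
      rw [show (k : ℤ) + 3 - 1 = k + 2 by ring, show (k : ℤ) + 3 - 2 = k + 1 by ring,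
        show (k : ℤ) + 3 - 3 = k by ring, a, b, c] at e
      refine ⟨b, ?_, ?_⟩
      · rw [← c]; congr 1
      · rw [show (k : ℤ) + 1 + 2 = k + 3 by ring, e]; rfl
    | pred k ih =>
      obtain ⟨a, b, c⟩ := ih
      have e := h (-(k : ℤ) + 2)
      rw [show -(k : ℤ) + 2 - 1 = -k + 1 by ring, show -(k : ℤ) + 2 - 2 = -k by ring,
        show -(k : ℤ) + 2 - 3 = -k - 1 by ring, a, b, c] at e
      refine ⟨by linarith, ?_, ?_⟩
      · rw [← a]; congr 1; ring
      · rw [← b]; congr 1; ring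
  exact (key n).1

lemma trib_neg (T : ℤ → ℤ) (hT : ∀ n : ℤ, T n = T (n - 1) + T (n - 2) + T (n - 3))
    (hT0 : T 0 = 0) (hT1 : T 1 = 1) (hT2 : T 2 = 1) : T (-1) = 0 ∧ T (-2) = 1 ∧ T (-3) = -1 := by
  have a := hT 2
  have b := hT 1
  have c := hT 0
  norm_num at a b c
  refine ⟨?_, ?_, ?_⟩ <;> linarith

lemma trib_add (T : ℤ → ℤ) (hT : ∀ n : ℤ, T n = T (n - 1) + T (n - 2) + T (n - 3))
    (hT0 : T 0 = 0) (hT1 : T 1 = 1) (hT2 : T 2 = 1)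
    (X : ℤ → ℤ) (h : ∀ n, X n = X (n - 1) + X (n - 2) + X (n - 3)) (a n : ℤ) :
    X (a + n) = T (n - 1) * X (a + 2) + (T (n - 2) + T (n - 3)) * X (a + 1)
      + T (n - 2) * X a := by
  obtain ⟨m1, m2, m3⟩ := trib_neg T hT hT0 hT1 hT2
  have := trib_zero_s8 (fun n => X (a + n) - (T (n - 1) * X (a + 2)
      + (T (n - 2) + T (n - 3)) * X (a + 1) + T (n - 2) * X a)) ?_ ?_ ?_ ?_ n
  · simpa [sub_eq_zero] using this
  · intro n
    have e1 := h (a + n)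
    have e2 := hT (n - 1)
    have e3 := hT (n - 2)
    have e4 := hT (n - 3)
    simp only [← add_sub_assoc]
    simp only [sub_sub] at *
    norm_num at *
    rw [e1, e2, e3, e4]
    ring
  · norm_num [m1, m2, m3]
  · norm_num [m1, m2, m3, hT0]
  · norm_num [m1, m2, m3, hT0, hT1]

/-- The determinant of the matrix of the shift by `n`. -/
def tribDet (p q s : ℤ) : ℤ :=
  (2 * p + 2 * q + s) * ((p + q) * q - p * (q + s))
    - (2 * p + q + s) * ((p + q + s) * q - p * p)
    + (p + q + s) * ((p + q + s) * (q + s) - (p + q) * p)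

lemma tribDet_eq (T : ℤ → ℤ) (hT : ∀ n : ℤ, T n = T (n - 1) + T (n - 2) + T (n - 3))
    (hT0 : T 0 = 0) (hT1 : T 1 = 1) (hT2 : T 2 = 1) (n : ℤ) :
    tribDet (T (n - 1)) (T (n - 2)) (T (n - 3)) = 1 := by
  obtain ⟨m1, m2, m3⟩ := trib_neg T hT hT0 hT1 hT2
  have step : ∀ n : ℤ, tribDet (T (n + 1 - 1)) (T (n + 1 - 2)) (T (n + 1 - 3))
      = tribDet (T (n - 1)) (T (n - 2)) (T (n - 3)) := by
    intro n
    rw [show n + 1 - 1 = n by ring, show n + 1 - 2 = n - 1 by ring,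
      show n + 1 - 3 = n - 2 by ring, hT n]
    unfold tribDet
    ring
  induction n using Int.induction_on with
  | zero => norm_num [m1, m2, m3, tribDet]
  | succ k ih => rw [step, ih]
  | pred k ih => rw [← step, sub_add_cancel, ih]

lemma lucas_eq (T : ℤ → ℤ) (hT : ∀ n : ℤ, T n = T (n - 1) + T (n - 2) + T (n - 3))
    (hT0 : T 0 = 0) (hT1 : T 1 = 1) (hT2 : T 2 = 1)
    (K : ℤ → ℤ) (hK : ∀ n : ℤ, K n = K (n - 1) + K (n - 2) + K (n - 3))
    (hK0 : K 0 = 3) (hK1 : K 1 = 1) (hK2 : K 2 = 3) (n : ℤ) :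
    K n = 3 * T (n - 1) + 4 * T (n - 2) + T (n - 3) := by
  have := trib_add T hT hT0 hT1 hT2 K hK 0 n
  simp only [zero_add, hK0, hK1, hK2] at this
  rw [this]
  ring

/-- The second invariant of the matrix of the shift by `n`. -/
def tribE (p q s : ℤ) : ℤ :=
  (q * (p + q) - (q + s) * p) + (q * (2 * p + 2 * q + s) - p * (p + q + s))
    + ((p + q) * (2 * p + 2 * q + s) - (p + q + s) * (2 * p + q + s))

lemma lucas_neg (T : ℤ → ℤ) (hT : ∀ n : ℤ, T n = T (n - 1) + T (n - 2) + T (n - 3))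
    (hT0 : T 0 = 0) (hT1 : T 1 = 1) (hT2 : T 2 = 1)
    (K : ℤ → ℤ) (hK : ∀ n : ℤ, K n = K (n - 1) + K (n - 2) + K (n - 3))
    (hK0 : K 0 = 3) (hK1 : K 1 = 1) (hK2 : K 2 = 3) (n : ℤ) :
    K (-n) = tribE (T (n - 1)) (T (n - 2)) (T (n - 3)) := by
  obtain ⟨m1, m2, m3⟩ := trib_neg T hT hT0 hT1 hT2
  have hD := tribDet_eq T hT hT0 hT1 hT2 n
  rw [lucas_eq T hT hT0 hT1 hT2 K hK hK0 hK1 hK2]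
  have E1 := trib_add T hT hT0 hT1 hT2 T hT (-n - 1) n
  have E2 := trib_add T hT hT0 hT1 hT2 T hT (-n - 2) n
  have E3 := trib_add T hT hT0 hT1 hT2 T hT (-n - 3) n
  have r1 := hT (-n)
  have r2 := hT (-n + 1)
  rw [show -n + 1 - 1 = -n by ring, show -n + 1 - 2 = -n - 1 by ring,
    show -n + 1 - 3 = -n - 2 by ring, r1] at r2
  rw [show -n - 1 + n = -1 by ring, show -n - 1 + 2 = -n + 1 by ring,
    show -n - 1 + 1 = -n by ring, m1, r1, r2] at E1
  rw [show -n - 2 + n = -2 by ring, show -n - 2 + 2 = -n by ring,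
    show -n - 2 + 1 = -n - 1 by ring, m2, r1] at E2
  rw [show -n - 3 + n = -3 by ring, show -n - 3 + 2 = -n - 1 by ring,
    show -n - 3 + 1 = -n - 2 by ring, m3] at E3
  clear r1 r2
  generalize T (n - 1) = p at *
  generalize T (n - 2) = q at *
  generalize T (n - 3) = s at *
  generalize T (-n - 1) = P at *
  generalize T (-n - 2) = Q at *
  generalize T (-n - 3) = S at *
  unfold tribDet at hD
  unfold tribE
  linear_combination (-(3 * P + 4 * Q + S)) * hD
    - (3 * ((p + q) * q - p * (q + s)) - 4 * ((p + q + s) * q - p * p)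
      + ((p + q + s) * (q + s) - (p + q) * p)) * E1
    - (-3 * ((2 * p + q + s) * q - (p + q + s) * (q + s))
      + 4 * ((2 * p + 2 * q + s) * q - (p + q + s) * p)
      - ((2 * p + 2 * q + s) * (q + s) - (2 * p + q + s) * p)) * E2
    - (3 * ((2 * p + q + s) * p - (p + q + s) * (p + q))
      - 4 * ((2 * p + 2 * q + s) * p - (p + q + s) * (p + q + s))
      + ((2 * p + 2 * q + s) * (p + q) - (2 * p + q + s) * (p + q + s))) * E3

lemma trib_key (T : ℤ → ℤ) (hT : ∀ n : ℤ, T n = T (n - 1) + T (n - 2) + T (n - 3))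
    (hT0 : T 0 = 0) (hT1 : T 1 = 1) (hT2 : T 2 = 1)
    (K : ℤ → ℤ) (hK : ∀ n : ℤ, K n = K (n - 1) + K (n - 2) + K (n - 3))
    (hK0 : K 0 = 3) (hK1 : K 1 = 1) (hK2 : K 2 = 3)
    (X : ℤ → ℤ) (h : ∀ n, X n = X (n - 1) + X (n - 2) + X (n - 3)) (b m : ℤ) :
    X (b + m + m + m) = K m * X (b + m + m) - K (-m) * X (b + m) + X b := by
  have hD := tribDet_eq T hT hT0 hT1 hT2 m
  rw [lucas_neg T hT hT0 hT1 hT2 K hK hK0 hK1 hK2, lucas_eq T hT hT0 hT1 hT2 K hK hK0 hK1 hK2]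
  have L : ∀ a, X (a + m) = T (m - 1) * X (a + 2) + (T (m - 2) + T (m - 3)) * X (a + 1)
      + T (m - 2) * X a := fun a => trib_add T hT hT0 hT1 hT2 X h a m
  have R : ∀ a, X (a + 3) = X (a + 2) + X (a + 1) + X a := by
    intro a
    rw [h (a + 3)]
    congr 2 <;> [congr 2; skip; skip] <;> ring_nf
  have L1 : ∀ a, X (a + m + 1) = T (m - 1) * (X (a + 2) + X (a + 1) + X a)
      + (T (m - 2) + T (m - 3)) * X (a + 2) + T (m - 2) * X (a + 1) := by
    intro a
    rw [show a + m + 1 = a + 1 + m by ring, L, show a + 1 + 2 = a + 3 by ring,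
      show a + 1 + 1 = a + 2 by ring, R]
  have L2 : ∀ a, X (a + m + 2) = T (m - 1) * (2 * X (a + 2) + 2 * X (a + 1) + X a)
      + (T (m - 2) + T (m - 3)) * (X (a + 2) + X (a + 1) + X a) + T (m - 2) * X (a + 2) := by
    intro a
    rw [show a + m + 2 = a + 2 + m by ring, L, show a + 2 + 2 = a + 1 + 3 by ring,
      show a + 2 + 1 = a + 3 by ring, R, R, show a + 1 + 2 = a + 3 by ring,
      show a + 1 + 1 = a + 2 by ring, R]
    ring
  simp only [L, L1, L2]
  generalize T (m - 1) = p at *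
  generalize T (m - 2) = q at *
  generalize T (m - 3) = s at *
  unfold tribDet at hD
  unfold tribE
  linear_combination (X b) * hD

lemma trib_sum (T : ℤ → ℤ) (hT : ∀ n : ℤ, T n = T (n - 1) + T (n - 2) + T (n - 3))
    (hT0 : T 0 = 0) (hT1 : T 1 = 1) (hT2 : T 2 = 1)
    (K : ℤ → ℤ) (hK : ∀ n : ℤ, K n = K (n - 1) + K (n - 2) + K (n - 3))
    (hK0 : K 0 = 3) (hK1 : K 1 = 1) (hK2 : K 2 = 3)
    (X : ℤ → ℤ) (h : ∀ n, X n = X (n - 1) + X (n - 2) + X (n - 3)) (m j : ℤ) (n : ℕ) :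
    (K m - K (-m)) * ∑ i ∈ Finset.range n, X (m * (i : ℤ) + j) =
        X (m * (n : ℤ) + m + j) + X (m * (n : ℤ) - m + j) +
          (1 - K m) * X (m * (n : ℤ) + j) -
        (X (m + j) + X (j - m) + (1 - K m) * X j) := by
  induction n with
  | zero =>
    simp only [Finset.range_zero, Finset.sum_empty, Nat.cast_zero, mul_zero, zero_add, zero_sub]
    rw [show -m + j = j - m by ring]
    ring
  | succ n ih =>
    rw [Finset.sum_range_succ, mul_add, ih]
    have k := trib_key T hT hT0 hT1 hT2 K hK hK0 hK1 hK2 X h (m * n - m + j) m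
    rw [show m * (n : ℤ) - m + j + m = m * n + j by ring,
      show m * (n : ℤ) + j + m = m * n + m + j by ring] at k
    push_cast
    rw [show m * ((n : ℤ) + 1) + m + j = m * n + m + j + m by ring,
      show m * ((n : ℤ) + 1) - m + j = m * n + j by ring,
      show m * ((n : ℤ) + 1) + j = m * n + m + j by ring, k]
    ring

theorem tribonacci_and_lucas_sum
    (T : ℤ → ℤ)
    (hT : ∀ n : ℤ, T n = T (n - 1) + T (n - 2) + T (n - 3))
    (hT0 : T 0 = 0) (hT1 : T 1 = 1) (hT2 : T 2 = 1)
    (K : ℤ → ℤ)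
    (hK : ∀ n : ℤ, K n = K (n - 1) + K (n - 2) + K (n - 3))
    (hK0 : K 0 = 3) (hK1 : K 1 = 1) (hK2 : K 2 = 3)
    (m j : ℤ) (hj : 0 ≤ j) (hjm : j < m) :
    ∀ n : ℕ,
      ((K m - K (-m)) * ∑ i ∈ Finset.range n, T (m * (i : ℤ) + j) =
        T (m * (n : ℤ) + m + j) + T (m * (n : ℤ) - m + j) +
          (1 - K m) * T (m * (n : ℤ) + j) -
        (T (m + j) + T (j - m) + (1 - K m) * T j)) ∧
      ((K m - K (-m)) * ∑ i ∈ Finset.range n, K (m * (i : ℤ) + j) =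
        K (m * (n : ℤ) + m + j) + K (m * (n : ℤ) - m + j) +
          (1 - K m) * K (m * (n : ℤ) + j) -
        (K (m + j) + K (j - m) + (1 - K m) * K j)) := by
  intro n
  exact ⟨trib_sum T hT hT0 hT1 hT2 K hK hK0 hK1 hK2 T hT m j n,
    trib_sum T hT hT0 hT1 hT2 K hK hK0 hK1 hK2 K hK m j n⟩
end

section
/- For every integer n ≥ 0, the matrix products satisfy 𝒦_0 · 𝒯_n = 𝒯_n · 𝒦_0 = 𝒦_n and 𝒯_0 · 𝒦_n = 𝒦_n · 𝒯_0 = 𝒦_n. -/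
theorem tribonacci_lucas_matrix_products
    (𝒯 : ℤ → Matrix (Fin 3) (Fin 3) ℤ)
    (h𝒯 : ∀ n : ℤ, 𝒯 n = 𝒯 (n - 1) + 𝒯 (n - 2) + 𝒯 (n - 3))
    (h𝒯0 : 𝒯 0 = 1)
    (h𝒯1 : 𝒯 1 = !![1, 1, 1; 1, 0, 0; 0, 1, 0])
    (h𝒯2 : 𝒯 2 = !![2, 2, 1; 1, 1, 1; 1, 0, 0])
    (𝒦 : ℤ → Matrix (Fin 3) (Fin 3) ℤ)
    (h𝒦 : ∀ n : ℤ, 𝒦 n = 𝒦 (n - 1) + 𝒦 (n - 2) + 𝒦 (n - 3))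
    (h𝒦0 : 𝒦 0 = !![1, 2, 3; 3, -2, -1; -1, 4, -1])
    (h𝒦1 : 𝒦 1 = !![3, 4, 1; 1, 2, 3; 3, -2, -1])
    (h𝒦2 : 𝒦 2 = !![7, 4, 3; 3, 4, 1; 1, 2, 3]) :
    ∀ n : ℤ, 0 ≤ n →
      (𝒦 0 * 𝒯 n = 𝒦 n ∧ 𝒯 n * 𝒦 0 = 𝒦 n) ∧
      (𝒯 0 * 𝒦 n = 𝒦 n ∧ 𝒦 n * 𝒯 0 = 𝒦 n) := by
  have key : ∀ n : ℕ, 𝒦 0 * 𝒯 n = 𝒦 n ∧ 𝒯 n * 𝒦 0 = 𝒦 n := by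
    intro n
    induction n using Nat.strong_induction_on with
    | _ n ih =>
      match n, ih with
      | 0, _ => simp [h𝒯0]
      | 1, _ =>
        simp only [Nat.cast_one, h𝒯1, h𝒦0, h𝒦1]
        decide
      | 2, _ =>
        simp only [Nat.cast_ofNat, h𝒯2, h𝒦0, h𝒦2]
        decide
      | m + 3, ih =>
        have a := ih m (by omega)
        have b := ih (m + 1) (by omega)
        have c := ih (m + 2) (by omega)
        have e1 : ((m + 3 : ℕ) : ℤ) - 1 = ((m + 2 : ℕ) : ℤ) := by push_cast; ring
        have e2 : ((m + 3 : ℕ) : ℤ) - 2 = ((m + 1 : ℕ) : ℤ) := by push_cast; ring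
        have e3 : ((m + 3 : ℕ) : ℤ) - 3 = (m : ℤ) := by push_cast; ring
        rw [h𝒯 ((m + 3 : ℕ) : ℤ), h𝒦 ((m + 3 : ℕ) : ℤ), e1, e2, e3]
        simp only [mul_add, add_mul, a.1, a.2, b.1, b.2, c.1, c.2, and_self]
  intro n hn
  lift n to ℕ using hn
  exact ⟨key n, by rw [h𝒯0, one_mul], by rw [h𝒯0, mul_one]⟩
end

section
/- For every integer n: (a) 22·T_n = K_n + 5K_{n−1} + 2K_{n+1}, where T and K are the Tribonacci and Tribonacci-Lucas numbers; (b) 22·𝒯_n = 𝒦_n + 5𝒦_{n−1} + 2𝒦_{n+1}, where 𝒯 and 𝒦 are the Tribonacci and Tribonacci-Lucas matrix sequences. -/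
theorem tribonacci_scalar_aux (T K : ℤ → ℤ)
    (hT : ∀ n : ℤ, T n = T (n - 1) + T (n - 2) + T (n - 3))
    (hK : ∀ n : ℤ, K n = K (n - 1) + K (n - 2) + K (n - 3))
    (h0 : 22 * T 0 = K 0 + 5 * (K 2 - K 1 - K 0) + 2 * K 1)
    (h1 : 22 * T 1 = K 1 + 5 * K 0 + 2 * K 2)
    (h2 : 22 * T 2 = K 2 + 5 * K 1 + 2 * (K 2 + K 1 + K 0)) (n : ℤ) :
    22 * T n = K n + 5 * K (n - 1) + 2 * K (n + 1) := by
  obtain ⟨f, hf⟩ : ∃ f : ℤ → ℤ,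
      ∀ n, f n = 22 * T n - (K n + 5 * K (n - 1) + 2 * K (n + 1)) := ⟨_, fun _ => rfl⟩
  have hrec : ∀ n, f (n + 3) = f (n + 2) + f (n + 1) + f n := by
    intro n
    have a := hT (n + 3)
    have b := hK (n + 3)
    have c := hK (n + 2)
    have d := hK (n + 4)
    simp only [hf]
    ring_nf at a b c d ⊢
    linarith
  have k2 := hK 2
  have k3 := hK 3
  norm_num at k2 k3
  have f0 : f 0 = 0 := by rw [hf]; norm_num; linarith
  have f1 : f 1 = 0 := by rw [hf]; norm_num; linarith
  have f2 : f 2 = 0 := by rw [hf]; norm_num; linarith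
  have key : ∀ n : ℤ, f n = 0 ∧ f (n + 1) = 0 ∧ f (n + 2) = 0 := by
    intro n
    induction n using Int.induction_on with
    | zero => simpa using ⟨f0, f1, f2⟩
    | succ i ih =>
      have a := hrec i
      obtain ⟨x, y, z⟩ := ih
      ring_nf at a x y z ⊢
      refine ⟨y, z, by linarith⟩
    | pred i ih =>
      have a := hrec (-(i : ℤ) - 1)
      obtain ⟨x, y, z⟩ := ih
      ring_nf at a x y z ⊢
      refine ⟨by linarith, x, y⟩
  have := (key n).1
  rw [hf] at this
  linarith

theorem tribonacci_from_lucas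
    (T : ℤ → ℤ)
    (hT : ∀ n : ℤ, T n = T (n - 1) + T (n - 2) + T (n - 3))
    (hT0 : T 0 = 0) (hT1 : T 1 = 1) (hT2 : T 2 = 1)
    (K : ℤ → ℤ)
    (hK : ∀ n : ℤ, K n = K (n - 1) + K (n - 2) + K (n - 3))
    (hK0 : K 0 = 3) (hK1 : K 1 = 1) (hK2 : K 2 = 3)
    (𝒯 : ℤ → Matrix (Fin 3) (Fin 3) ℤ)
    (h𝒯 : ∀ n : ℤ, 𝒯 n = 𝒯 (n - 1) + 𝒯 (n - 2) + 𝒯 (n - 3))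
    (h𝒯0 : 𝒯 0 = 1)
    (h𝒯1 : 𝒯 1 = !![1, 1, 1; 1, 0, 0; 0, 1, 0])
    (h𝒯2 : 𝒯 2 = !![2, 2, 1; 1, 1, 1; 1, 0, 0])
    (𝒦 : ℤ → Matrix (Fin 3) (Fin 3) ℤ)
    (h𝒦 : ∀ n : ℤ, 𝒦 n = 𝒦 (n - 1) + 𝒦 (n - 2) + 𝒦 (n - 3))
    (h𝒦0 : 𝒦 0 = !![1, 2, 3; 3, -2, -1; -1, 4, -1])
    (h𝒦1 : 𝒦 1 = !![3, 4, 1; 1, 2, 3; 3, -2, -1])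
    (h𝒦2 : 𝒦 2 = !![7, 4, 3; 3, 4, 1; 1, 2, 3]) :
    ∀ n : ℤ,
      (22 * T n = K n + 5 * K (n - 1) + 2 * K (n + 1)) ∧
      (22 • 𝒯 n = 𝒦 n + 5 • 𝒦 (n - 1) + 2 • 𝒦 (n + 1)) := by
  intro n
  refine ⟨?_, ?_⟩
  · apply tribonacci_scalar_aux T K hT hK <;> simp [hT0, hT1, hT2, hK0, hK1, hK2]
  · ext i j
    have h := tribonacci_scalar_aux (fun n => 𝒯 n i j) (fun n => 𝒦 n i j)
      (fun n => by simpa using congrFun (congrFun (h𝒯 n) i) j)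
      (fun n => by simpa using congrFun (congrFun (h𝒦 n) i) j)
      (by simp only [h𝒯0, h𝒦0, h𝒦1, h𝒦2]; revert i j; decide)
      (by simp only [h𝒯1, h𝒦0, h𝒦1, h𝒦2]; revert i j; decide)
      (by simp only [h𝒯2, h𝒦0, h𝒦1, h𝒦2]; revert i j; decide) n
    simp only [Matrix.add_apply, Matrix.smul_apply]
    simp only [nsmul_eq_mul]
    exact_mod_cast h
end

section
/- For all non-negative integers m and n: (a) 𝒯_m · 𝒯_n = 𝒯_{m+n} = 𝒯_n · 𝒯_m; (b) 𝒯_m · 𝒦_n = 𝒦_n · 𝒯_m = 𝒦_{m+n}. -/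
theorem trib_aux {R : Type*} [Ring R] (A C : R) (hA : A ^ 3 = A ^ 2 + A + 1)
    (F : ℤ → R) (hF : ∀ n : ℤ, F n = F (n - 1) + F (n - 2) + F (n - 3))
    (h0 : F 0 = C) (h1 : F 1 = A * C) (h2 : F 2 = A ^ 2 * C) (n : ℕ) :
    F n = A ^ n * C ∧ F ((n : ℤ) + 1) = A ^ (n + 1) * C ∧ F ((n : ℤ) + 2) = A ^ (n + 2) * C := by
  induction n with
  | zero => simp [h0, h1, h2]
  | succ k ih =>
    obtain ⟨a, b, c⟩ := ih
    have e : ((k : ℤ) + 1 + 1) = k + 2 := by ring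
    push_cast
    refine ⟨b, by rw [e]; exact c, ?_⟩
    rw [hF, show (k : ℤ) + 1 + 2 - 1 = k + 2 by ring, show (k : ℤ) + 1 + 2 - 2 = k + 1 by ring,
      show (k : ℤ) + 1 + 2 - 3 = k by ring, a, b, c, show k + 1 + 2 = k + 3 by ring,
      pow_add A k 3, hA]
    simp only [pow_add, mul_add, add_mul, pow_one, mul_one]

theorem tribonacci_matrix_mul_add
    (𝒯 : ℤ → Matrix (Fin 3) (Fin 3) ℤ)
    (h𝒯 : ∀ n : ℤ, 𝒯 n = 𝒯 (n - 1) + 𝒯 (n - 2) + 𝒯 (n - 3))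
    (h𝒯0 : 𝒯 0 = 1)
    (h𝒯1 : 𝒯 1 = !![1, 1, 1; 1, 0, 0; 0, 1, 0])
    (h𝒯2 : 𝒯 2 = !![2, 2, 1; 1, 1, 1; 1, 0, 0])
    (𝒦 : ℤ → Matrix (Fin 3) (Fin 3) ℤ)
    (h𝒦 : ∀ n : ℤ, 𝒦 n = 𝒦 (n - 1) + 𝒦 (n - 2) + 𝒦 (n - 3))
    (h𝒦0 : 𝒦 0 = !![1, 2, 3; 3, -2, -1; -1, 4, -1])
    (h𝒦1 : 𝒦 1 = !![3, 4, 1; 1, 2, 3; 3, -2, -1])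
    (h𝒦2 : 𝒦 2 = !![7, 4, 3; 3, 4, 1; 1, 2, 3]) :
    ∀ m n : ℕ,
      (𝒯 (m : ℤ) * 𝒯 (n : ℤ) = 𝒯 ((m : ℤ) + n) ∧
        𝒯 (n : ℤ) * 𝒯 (m : ℤ) = 𝒯 ((m : ℤ) + n)) ∧
      (𝒯 (m : ℤ) * 𝒦 (n : ℤ) = 𝒦 ((m : ℤ) + n) ∧
        𝒦 (n : ℤ) * 𝒯 (m : ℤ) = 𝒦 ((m : ℤ) + n)) := by
  set A : Matrix (Fin 3) (Fin 3) ℤ := !![1, 1, 1; 1, 0, 0; 0, 1, 0] with hAdef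
  have hA2 : A ^ 2 = !![2, 2, 1; 1, 1, 1; 1, 0, 0] := by rw [hAdef]; decide
  have hA : A ^ 3 = A ^ 2 + A + 1 := by rw [hAdef]; decide
  have hT : ∀ n : ℕ, 𝒯 n = A ^ n := fun n => by
    have := (trib_aux A 1 hA 𝒯 h𝒯 h𝒯0 (by rw [h𝒯1, mul_one]) (by rw [h𝒯2, hA2, mul_one]) n).1
    rwa [mul_one] at this
  have hK : ∀ n : ℕ, 𝒦 n = A ^ n * 𝒦 0 := fun n =>
    (trib_aux A (𝒦 0) hA 𝒦 h𝒦 rfl (by rw [h𝒦1, h𝒦0, hAdef]; decide)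
      (by rw [h𝒦2, h𝒦0, hA2]; decide) n).1
  have hc : Commute (𝒦 0) A := by
    change 𝒦 0 * A = A * 𝒦 0
    rw [h𝒦0, hAdef]; decide
  intro m n
  have e : (m : ℤ) + n = ((m + n : ℕ) : ℤ) := by push_cast; rfl
  rw [e, hT m, hT n, hT (m + n), hK n, hK (m + n)]
  refine ⟨⟨(pow_add A m n).symm, by rw [← pow_add, add_comm]⟩, by rw [← mul_assoc, pow_add], ?_⟩
  rw [mul_assoc, (hc.pow_right m).eq, ← mul_assoc, ← pow_add, add_comm]
end

section
/- For all non-negative integers m and n, the product 𝒦_m · 𝒦_n = 𝒦_n · 𝒦_m equals each of the following: (a) 9𝒯_{m+n+2} − 12𝒯_{m+n+1} − 2𝒯_{m+n} + 4𝒯_{m+n−1} + 𝒯_{m+n−2}; (b) 𝒯_{m+n} + 4𝒯_{m+n−1} + 10𝒯_{m+n−2} + 12𝒯_{m+n−3} + 9𝒯_{m+n−4}; (c) 𝒯_{m+n} − 8𝒯_{m+n+1} + 18𝒯_{m+n+2} − 8𝒯_{m+n+3} + 𝒯_{m+n+4}. -/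
theorem tribonacci_lucas_matrix_mul
    (𝒯 : ℤ → Matrix (Fin 3) (Fin 3) ℤ)
    (h𝒯 : ∀ n : ℤ, 𝒯 n = 𝒯 (n - 1) + 𝒯 (n - 2) + 𝒯 (n - 3))
    (h𝒯0 : 𝒯 0 = 1)
    (h𝒯1 : 𝒯 1 = !![1, 1, 1; 1, 0, 0; 0, 1, 0])
    (h𝒯2 : 𝒯 2 = !![2, 2, 1; 1, 1, 1; 1, 0, 0])
    (𝒦 : ℤ → Matrix (Fin 3) (Fin 3) ℤ)
    (h𝒦 : ∀ n : ℤ, 𝒦 n = 𝒦 (n - 1) + 𝒦 (n - 2) + 𝒦 (n - 3))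
    (h𝒦0 : 𝒦 0 = !![1, 2, 3; 3, -2, -1; -1, 4, -1])
    (h𝒦1 : 𝒦 1 = !![3, 4, 1; 1, 2, 3; 3, -2, -1])
    (h𝒦2 : 𝒦 2 = !![7, 4, 3; 3, 4, 1; 1, 2, 3]) :
    ∀ m n : ℕ,
      (𝒦 (m : ℤ) * 𝒦 (n : ℤ) = 𝒦 (n : ℤ) * 𝒦 (m : ℤ)) ∧
      (𝒦 (m : ℤ) * 𝒦 (n : ℤ) =
        9 • 𝒯 ((m : ℤ) + n + 2) - 12 • 𝒯 ((m : ℤ) + n + 1) - 2 • 𝒯 ((m : ℤ) + n) +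
          4 • 𝒯 ((m : ℤ) + n - 1) + 𝒯 ((m : ℤ) + n - 2)) ∧
      (𝒦 (m : ℤ) * 𝒦 (n : ℤ) =
        𝒯 ((m : ℤ) + n) + 4 • 𝒯 ((m : ℤ) + n - 1) + 10 • 𝒯 ((m : ℤ) + n - 2) +
          12 • 𝒯 ((m : ℤ) + n - 3) + 9 • 𝒯 ((m : ℤ) + n - 4)) ∧
      (𝒦 (m : ℤ) * 𝒦 (n : ℤ) =
        𝒯 ((m : ℤ) + n) - 8 • 𝒯 ((m : ℤ) + n + 1) + 18 • 𝒯 ((m : ℤ) + n + 2) -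
          8 • 𝒯 ((m : ℤ) + n + 3) + 𝒯 ((m : ℤ) + n + 4)) := by
  -- every solution of the recurrence is `A ^ n * X 0`
  have key : ∀ (A : Matrix (Fin 3) (Fin 3) ℤ) (X : ℤ → Matrix (Fin 3) (Fin 3) ℤ),
      A ^ 3 = A ^ 2 + A + 1 →
      (∀ n : ℤ, X n = X (n - 1) + X (n - 2) + X (n - 3)) →
      X 1 = A * X 0 → X 2 = A ^ 2 * X 0 → ∀ n : ℕ,
      X (n : ℤ) = A ^ n * X 0 ∧ X ((n : ℤ) + 1) = A ^ (n + 1) * X 0 ∧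
        X ((n : ℤ) + 2) = A ^ (n + 2) * X 0 := by
    intro A X hA hX h1 h2 n
    induction n with
    | zero => simp [h1, h2]
    | succ k ih =>
      obtain ⟨i0, i1, i2⟩ := ih
      have e1 : (((k + 1 : ℕ) : ℤ)) = (k : ℤ) + 1 := by push_cast; ring
      have e2 : (k : ℤ) + 1 + 1 = k + 2 := by ring
      refine ⟨by rw [e1, i1], by rw [e1, e2, i2], ?_⟩
      rw [e1, hX, show (k : ℤ) + 1 + 2 - 1 = k + 2 by ring,
        show (k : ℤ) + 1 + 2 - 2 = k + 1 by ring, show (k : ℤ) + 1 + 2 - 3 = k by ring,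
        i0, i1, i2, show k + 1 + 2 = k + 3 by ring, pow_add A k 3, hA]
      noncomm_ring
  obtain ⟨A, hAdef⟩ : ∃ A : Matrix (Fin 3) (Fin 3) ℤ, A = !![1, 1, 1; 1, 0, 0; 0, 1, 0] :=
    ⟨_, rfl⟩
  have hA2 : A ^ 2 = !![2, 2, 1; 1, 1, 1; 1, 0, 0] := by subst hAdef; decide
  have hA3 : A ^ 3 = A ^ 2 + A + 1 := by subst hAdef; decide
  have kT := key A 𝒯 hA3 h𝒯 (by rw [h𝒯1, h𝒯0, hAdef, mul_one]) (by rw [h𝒯2, h𝒯0, hA2, mul_one])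
  have kK := key A 𝒦 hA3 h𝒦 (by rw [h𝒦1, h𝒦0, hAdef]; decide)
    (by rw [h𝒦2, h𝒦0, hA2]; decide)
  have hc : Commute A (𝒦 0) := by
    rw [h𝒦0, hAdef]; show _ * _ = _ * _; decide
  have hsq : 𝒦 0 * 𝒦 0 = 12 • A ^ 2 - 14 • A - 6 • (1 : Matrix (Fin 3) (Fin 3) ℤ) := by
    rw [h𝒦0, hA2, hAdef]; decide
  have hprod : ∀ m n : ℕ, 𝒦 (m : ℤ) * 𝒦 (n : ℤ) = A ^ (m + n) * (𝒦 0 * 𝒦 0) := by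
    intro m n
    rw [(kK m).1, (kK n).1, pow_add, mul_assoc, ← mul_assoc (𝒦 0), ← (hc.pow_left n).eq]
    simp only [mul_assoc]
  intro m n
  have hN : 𝒦 (m : ℤ) * 𝒦 (n : ℤ) = 12 • 𝒯 ((m : ℤ) + n + 2) - 14 • 𝒯 ((m : ℤ) + n + 1)
      - 6 • 𝒯 ((m : ℤ) + n) := by
    obtain ⟨t0, t1, t2⟩ := kT (m + n)
    push_cast at t0 t1 t2
    rw [hprod, hsq, t0, t1, t2, h𝒯0, pow_add A (m + n) 2, pow_add A (m + n) 1]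
    noncomm_ring
  refine ⟨by rw [hprod, hprod, add_comm], ?_⟩
  rw [hN]
  generalize (m : ℤ) + n = N
  have step : ∀ a b c d : ℤ, b = a - 1 → c = a - 2 → d = a - 3 →
      𝒯 a = 𝒯 b + 𝒯 c + 𝒯 d := by
    rintro a b c d rfl rfl rfl
    exact h𝒯 a
  have r3 := step (N + 3) (N + 2) (N + 1) N (by ring) (by ring) (by ring)
  have r4 := step (N + 4) (N + 3) (N + 2) (N + 1) (by ring) (by ring) (by ring)
  have s1 : 𝒯 (N - 1) = 𝒯 (N + 2) - 𝒯 (N + 1) - 𝒯 N := by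
    rw [step (N + 2) (N + 1) N (N - 1) (by ring) (by ring) (by ring)]; abel
  have s2 : 𝒯 (N - 2) = 𝒯 (N + 1) - 𝒯 N - 𝒯 (N - 1) := by
    rw [step (N + 1) N (N - 1) (N - 2) (by ring) (by ring) (by ring)]; abel
  have s3 : 𝒯 (N - 3) = 𝒯 N - 𝒯 (N - 1) - 𝒯 (N - 2) := by
    rw [step N (N - 1) (N - 2) (N - 3) (by ring) (by ring) (by ring)]; abel
  have s4 : 𝒯 (N - 4) = 𝒯 (N - 1) - 𝒯 (N - 2) - 𝒯 (N - 3) := by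
    rw [step (N - 1) (N - 2) (N - 3) (N - 4) (by ring) (by ring) (by ring)]; abel
  rw [s4, s3, s2, s1, r4, r3]
  refine ⟨?_, ?_, ?_⟩ <;> module
end

section
/- For all non-negative integers m and n, and every integer n with n ≥ r ≥ 0: (a) 𝒯_n^m = 𝒯_{mn} (the m-th matrix power of 𝒯_n equals 𝒯_{mn}); (b) 𝒯_{n+1}^m = 𝒯_1^m · 𝒯_{mn}; (c) 𝒯_{n−r} · 𝒯_{n+r} = 𝒯_n² = 𝒯_2^n. -/
theorem tribonacci_matrix_powers
    (𝒯 : ℤ → Matrix (Fin 3) (Fin 3) ℤ)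
    (h𝒯 : ∀ n : ℤ, 𝒯 n = 𝒯 (n - 1) + 𝒯 (n - 2) + 𝒯 (n - 3))
    (h𝒯0 : 𝒯 0 = 1)
    (h𝒯1 : 𝒯 1 = !![1, 1, 1; 1, 0, 0; 0, 1, 0])
    (h𝒯2 : 𝒯 2 = !![2, 2, 1; 1, 1, 1; 1, 0, 0]) :
    ∀ m n r : ℕ, r ≤ n →
      (𝒯 (n : ℤ) ^ m = 𝒯 ((m : ℤ) * n)) ∧
      (𝒯 ((n : ℤ) + 1) ^ m = 𝒯 1 ^ m * 𝒯 ((m : ℤ) * n)) ∧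
      (𝒯 ((n : ℤ) - r) * 𝒯 ((n : ℤ) + r) = 𝒯 (n : ℤ) ^ 2 ∧
        𝒯 (n : ℤ) ^ 2 = 𝒯 2 ^ n) := by
  have hsq : 𝒯 2 = 𝒯 1 ^ 2 := by
    rw [h𝒯1, h𝒯2]; decide
  have hcu : 𝒯 1 ^ 3 = 𝒯 1 ^ 2 + 𝒯 1 + 1 := by
    rw [h𝒯1]; decide
  have key : ∀ k : ℕ, 𝒯 (k : ℤ) = 𝒯 1 ^ k ∧ 𝒯 ((k : ℤ) + 1) = 𝒯 1 ^ (k + 1) ∧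
      𝒯 ((k : ℤ) + 2) = 𝒯 1 ^ (k + 2) := by
    intro k
    induction k with
    | zero => simp [h𝒯0, hsq]
    | succ k ih =>
      obtain ⟨h0, h1, h2⟩ := ih
      have e1 : ((k + 1 : ℕ) : ℤ) = (k : ℤ) + 1 := by push_cast; ring
      have e2 : ((k + 1 : ℕ) : ℤ) + 1 = (k : ℤ) + 2 := by push_cast; ring
      refine ⟨by rw [e1, h1], by rw [e2, h2], ?_⟩
      rw [h𝒯, show ((k + 1 : ℕ) : ℤ) + 2 - 1 = (k : ℤ) + 2 by push_cast; ring,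
        show ((k + 1 : ℕ) : ℤ) + 2 - 2 = (k : ℤ) + 1 by push_cast; ring,
        show ((k + 1 : ℕ) : ℤ) + 2 - 3 = (k : ℤ) by push_cast; ring, h0, h1, h2,
        show k + 1 + 2 = k + 3 by ring, pow_add _ k 3, hcu, mul_add, mul_add, mul_one,
        ← pow_add, ← pow_succ]
  have key0 : ∀ k : ℕ, 𝒯 (k : ℤ) = 𝒯 1 ^ k := fun k => (key k).1
  intro m n r hr
  have hmn : 𝒯 ((m : ℤ) * n) = 𝒯 1 ^ (m * n) := by
    rw [← key0]; push_cast; rfl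
  have hsub : 𝒯 ((n : ℤ) - r) = 𝒯 1 ^ (n - r) := by
    rw [← key0, Nat.cast_sub hr]
  have hadd : 𝒯 ((n : ℤ) + r) = 𝒯 1 ^ (n + r) := by
    rw [← key0]; push_cast; rfl
  refine ⟨?_, ?_, ?_, ?_⟩
  · rw [hmn, key0, ← pow_mul, mul_comm]
  · rw [hmn, (key n).2.1, ← pow_mul, ← pow_add]
    congr 1; ring
  · rw [hsub, hadd, key0, ← pow_mul, ← pow_add]
    congr 1; omega
  · rw [hsq, key0, ← pow_mul, ← pow_mul, mul_comm]
end
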